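/- arXiv:2010.00657 — 10 statements merged into one kernel-verified Lean document; each statement's English description precedes it below -/
import Mathlib

section
/- Let B' be a finite product of principal ideal domains and let B ⊆ B' be a subring such that the additive quotient group B'/B is finite. Let A be an m×m matrix with entries in B whose determinant x is a non-zerodivisor in B', and suppose that the quotient ring B/xB is finite. Then the B-module N = B^m/(A·B^m) is finite and #N = #(B/xB). -/
theorem aux_comp {G H K : Type*} [AddCommGroup G] [AddCommGroup H] [AddCommGroup K]
    (f : H →+ K) (g : G →+ H) (hf : Function.Injective f) :
    (f.comp g).range.index = g.range.index * f.range.index := by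
  rw [AddMonoidHom.range_comp, AddSubgroup.index_map_of_injective _ hf]

theorem aux_surj {G H : Type*} [AddCommGroup G] [AddCommGroup H]
    (f : G →+ H) (hf : Function.Surjective f) : f.range.index = 1 := by
  rw [AddMonoidHom.range_eq_top_of_surjective f hf, AddSubgroup.index_top]

theorem aux_conj {G H : Type*} [AddCommGroup G] [AddCommGroup H]
    (j : H →+ G) (f : G →+ G) (g : H →+ H) (hj : Function.Injective j)
    (hf : Function.Injective f) (hc : ∀ x, j (g x) = f (j x)) (hi : j.range.index ≠ 0) :
    g.range.index = f.range.index := by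
  have h1 := aux_comp j g hj
  have h2 := aux_comp f j hf
  have h3 : j.comp g = f.comp j := AddMonoidHom.ext hc
  rw [h3, h2, mul_comm] at h1
  exact (Nat.eq_of_mul_eq_mul_right (Nat.pos_of_ne_zero hi) h1).symm

theorem aux_pi {ι : Type*} [Fintype ι] {G H : ι → Type*} [∀ i, AddCommGroup (G i)]
    [∀ i, AddCommGroup (H i)] (f : ∀ i, G i →+ H i) (F : (∀ i, G i) →+ (∀ i, H i))
    (hF : ∀ x i, F x i = f i (x i)) :
    F.range.index = ∏ i, (f i).range.index := by
  let q : (∀ i, H i) →+ (∀ i, H i ⧸ (f i).range) :=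
    { toFun := fun x i => QuotientAddGroup.mk' _ (x i)
      map_zero' := by ext i; simp
      map_add' := by intro x y; ext i; simp }
  have hq : Function.Surjective q := by
    intro y
    choose x hx using fun i => QuotientAddGroup.mk'_surjective _ (y i)
    exact ⟨x, funext hx⟩
  have hk : q.ker = F.range := by
    ext x
    have : q x = 0 ↔ ∀ i, x i ∈ (f i).range := by
      rw [funext_iff]
      exact forall_congr' fun i => QuotientAddGroup.eq_zero_iff _
    rw [AddMonoidHom.mem_ker, this]
    constructor
    · intro h
      choose y hy using h
      exact ⟨y, funext fun i => by rw [hF, hy]⟩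
    · rintro ⟨y, rfl⟩ i
      exact ⟨y i, (hF y i).symm⟩
  rw [← hk, AddSubgroup.index_ker, AddMonoidHom.range_eq_top_of_surjective q hq,
    AddSubgroup.card_top, Nat.card_pi]
  rfl

theorem aux_mul {R : Type*} [CommRing R] [IsDomain R] {x : R} (hx : x ≠ 0) (y : R) :
    (AddMonoidHom.mulLeft (x * y)).range.index =
      (AddMonoidHom.mulLeft x).range.index * (AddMonoidHom.mulLeft y).range.index := by
  rw [mul_comm (AddSubgroup.index _), ← aux_comp]
  · congr 2; ext z; simp [mul_assoc]
  · exact mul_right_injective₀ hx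

theorem aux_unit {R : Type*} [CommRing R] {x : R} (hx : IsUnit x) :
    (AddMonoidHom.mulLeft x).range.index = 1 := by
  apply aux_surj
  obtain ⟨u, rfl⟩ := hx
  intro y
  exact ⟨↑u⁻¹ * y, by simp⟩

theorem aux_prod {R : Type*} [CommRing R] [IsDomain R] {ι : Type*} (s : Finset ι) (a : ι → R)
    (ha : ∀ i, a i ≠ 0) :
    (AddMonoidHom.mulLeft (∏ i ∈ s, a i)).range.index =
      ∏ i ∈ s, (AddMonoidHom.mulLeft (a i)).range.index := by
  classical
  induction s using Finset.induction_on with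
  | empty => simpa using aux_unit isUnit_one
  | insert i s hi ih => rw [Finset.prod_insert hi, Finset.prod_insert hi, aux_mul (ha i), ih]

theorem aux_pid {R : Type*} [CommRing R] [IsDomain R] [IsPrincipalIdealRing R] {m : ℕ}
    (A : Matrix (Fin m) (Fin m) R) (hA : A.det ≠ 0) :
    (A.mulVecLin.toAddMonoidHom).range.index = (AddMonoidHom.mulLeft A.det).range.index := by
  have hinj : Function.Injective A.mulVecLin :=
    Matrix.mulVec_injective_of_det_mem_nonZeroDivisors (mem_nonZeroDivisors_of_ne_zero hA)
  obtain ⟨b, a, ab, hab⟩ := Submodule.exists_smith_normal_form_of_rank_eq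
    (N := LinearMap.range A.mulVecLin) (Pi.basisFun R (Fin m))
    (LinearMap.finrank_range_of_inj hinj)
  have ha : ∀ i, a i ≠ 0 := by
    intro i hi
    apply ab.ne_zero i
    apply Subtype.ext
    simp [hab, hi]
  let P : (Fin m → R) ≃ₗ[R] (Fin m → R) := b.equivFun.symm
  let Q : (Fin m → R) ≃ₗ[R] (Fin m → R) := (LinearEquiv.ofInjective _ hinj).trans ab.equivFun
  let D := (Matrix.diagonal a).mulVecLin
  have hfac : A.mulVecLin = P.toLinearMap ∘ₗ D ∘ₗ Q.toLinearMap := by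
    ext1 i
    ext1
    set v := (LinearMap.single R (fun _ => R) i) 1
    have h1 : ((LinearEquiv.ofInjective _ hinj v : LinearMap.range A.mulVecLin) : Fin m → R)
      = A.mulVecLin v := rfl
    have h2 := ab.sum_equivFun (LinearEquiv.ofInjective _ hinj v)
    have h3 := congrArg Subtype.val h2
    rw [h1] at h3
    change A.mulVecLin v = P (D (Q v))
    rw [← h3]
    simp only [P, D, Module.Basis.equivFun_symm_apply, Submodule.coe_sum, Submodule.coe_smul, hab,
      Matrix.mulVecLin_apply, Matrix.mulVec_diagonal, smul_smul]
    refine Finset.sum_congr rfl fun k _ => ?_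
    rw [mul_comm]; rfl
  have hDinj : Function.Injective D := by
    intro x y h
    funext i
    have := congrFun h i
    simp only [D, Matrix.mulVecLin_apply, Matrix.mulVec_diagonal] at this
    exact mul_left_cancel₀ (ha i) this
  have hdet : A.det = LinearMap.det P.toLinearMap * ((∏ i, a i) * LinearMap.det Q.toLinearMap) := by
    have : LinearMap.det A.mulVecLin = A.det := LinearMap.det_toLin' A
    rw [← this, hfac, LinearMap.det_comp, LinearMap.det_comp]
    congr 2
    exact (LinearMap.det_toLin' (Matrix.diagonal a)).trans Matrix.det_diagonal
  have hpu := P.isUnit_det'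
  have hqu := Q.isUnit_det'
  rw [hdet, aux_mul hpu.ne_zero, aux_mul (Finset.prod_ne_zero_iff.mpr fun i _ => ha i),
    aux_unit hpu, aux_unit hqu, aux_prod _ _ ha, hfac]
  have e1 : (P.toLinearMap ∘ₗ D ∘ₗ Q.toLinearMap).toAddMonoidHom =
    P.toLinearMap.toAddMonoidHom.comp (D.toAddMonoidHom.comp Q.toLinearMap.toAddMonoidHom) := rfl
  rw [e1, aux_comp _ _ P.injective, aux_comp _ _ hDinj, aux_surj P.toLinearMap.toAddMonoidHom P.surjective,
    aux_surj Q.toLinearMap.toAddMonoidHom Q.surjective, aux_pi (fun i => AddMonoidHom.mulLeft (a i)) D.toAddMonoidHom]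
  · simp
  · intro x i
    simp [D, Matrix.mulVec_diagonal]

theorem aux_pipid {ι : Type*} [Fintype ι] (P : ι → Type*)
    [∀ i, CommRing (P i)] [∀ i, IsDomain (P i)] [∀ i, IsPrincipalIdealRing (P i)]
    {m : ℕ} (A : Matrix (Fin m) (Fin m) (∀ i, P i))
    (hdet : A.det ∈ nonZeroDivisors (∀ i, P i)) :
    (A.mulVecLin.toAddMonoidHom).range.index = (AddMonoidHom.mulLeft A.det).range.index := by
  classical
  have hinj : Function.Injective A.mulVecLin :=
    Matrix.mulVec_injective_of_det_mem_nonZeroDivisors hdet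
  let A' : ∀ i, Matrix (Fin m) (Fin m) (P i) := fun i => A.map (Pi.evalRingHom P i)
  have hd : ∀ i, (A' i).det = A.det i := fun i =>
    ((Pi.evalRingHom P i).map_det A).symm
  have hne : ∀ i, A.det i ≠ 0 := by
    intro i hi
    have h0 : (Pi.single i (1 : P i) : ∀ i, P i) = 0 := by
      apply (mem_nonZeroDivisors_iff.mp hdet).2
      funext k
      by_cases hk : k = i
      · subst hk; simp [hi]
      · simp [hk]
    have := congrFun h0 i
    simp at this
  let F : (∀ i, Fin m → P i) →+ (∀ i, Fin m → P i) :=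
    { toFun := fun x i => (A' i).mulVecLin (x i)
      map_zero' := by funext i; exact map_zero _
      map_add' := by intro x y; funext i; exact map_add _ _ _ }
  have hFinj : Function.Injective F := by
    intro x y h
    funext i
    refine Matrix.mulVec_injective_of_det_mem_nonZeroDivisors (M := A' i)
      (mem_nonZeroDivisors_of_ne_zero ((hd i).symm ▸ hne i)) (congrFun h i)
  let j : (Fin m → ∀ i, P i) →+ (∀ i, Fin m → P i) :=
    { toFun := fun x i k => x k i
      map_zero' := rfl
      map_add' := fun _ _ => rfl }
  have hj : Function.Bijective j := (Equiv.piComm (fun (_ : Fin m) i => P i)).bijective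
  rw [aux_conj j F A.mulVecLin.toAddMonoidHom hj.1 hFinj ?_ ?_,
    aux_pi (fun i => (A' i).mulVecLin.toAddMonoidHom) F (fun _ _ => rfl),
    aux_pi (fun i => AddMonoidHom.mulLeft (A.det i)) (AddMonoidHom.mulLeft A.det)
      (fun _ _ => rfl)]
  · refine Finset.prod_congr rfl fun i _ => ?_
    rw [aux_pid _ ((hd i).symm ▸ hne i), hd]
  · intro x
    funext i k
    simp [j, F, A', Matrix.mulVec, dotProduct]
  · rw [aux_surj j hj.2]; exact one_ne_zero


set_option synthInstance.maxHeartbeats 400000 in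
/-- Let `B'` be a finite product of PIDs and `B ⊆ B'` a subring of finite additive index.
Let `A` be an `m × m` matrix over `B` whose determinant is a non-zerodivisor in `B'`, and
suppose `B / (det A)` is finite.  Then `N = B^m / (A · B^m)` is finite and
`#N = #(B / (det A))`. -/
theorem stmt_1 {ι : Type*} [Fintype ι] (P : ι → Type*)
    [∀ i, CommRing (P i)] [∀ i, IsDomain (P i)] [∀ i, IsPrincipalIdealRing (P i)]
    (B : Subring (∀ i, P i))
    (hBfin : Finite ((∀ i, P i) ⧸ B.toAddSubgroup))
    {m : ℕ} (A : Matrix (Fin m) (Fin m) B)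
    (hdet : (↑A.det : ∀ i, P i) ∈ nonZeroDivisors (∀ i, P i))
    (hquot : Finite (B ⧸ Ideal.span {A.det})) :
    Finite ((Fin m → B) ⧸ LinearMap.range (Matrix.mulVecLin A)) ∧
      Nat.card ((Fin m → B) ⧸ LinearMap.range (Matrix.mulVecLin A)) =
        Nat.card (B ⧸ Ideal.span {A.det}) := by
  have hi : B.subtype.toAddMonoidHom.range.index ≠ 0 := by
    have h : B.subtype.toAddMonoidHom.range = B.toAddSubgroup := by
      ext x
      constructor
      · rintro ⟨y, rfl⟩; exact y.2
      · intro hx; exact ⟨⟨x, hx⟩, rfl⟩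
    rw [h]
    exact Nat.card_ne_zero.mpr ⟨⟨0⟩, hBfin⟩
  let A' : Matrix (Fin m) (Fin m) (∀ i, P i) := A.map B.subtype
  have hd : A'.det = (↑A.det : ∀ i, P i) := (B.subtype.map_det A).symm
  have hdet' : A'.det ∈ nonZeroDivisors (∀ i, P i) := hd ▸ hdet
  let J : (Fin m → B) →+ (Fin m → ∀ i, P i) :=
    { toFun := fun x k => B.subtype (x k)
      map_zero' := rfl
      map_add' := fun _ _ => rfl }
  have hJi : J.range.index ≠ 0 := by
    rw [aux_pi (fun _ => B.subtype.toAddMonoidHom) J (fun _ _ => rfl)]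
    exact Finset.prod_ne_zero_iff.mpr fun _ _ => hi
  have h1 : A.mulVecLin.toAddMonoidHom.range.index = A'.mulVecLin.toAddMonoidHom.range.index := by
    refine aux_conj J _ _ ?_ ?_ ?_ hJi
    · intro x y h
      funext k
      exact Subtype.ext (congrFun h k)
    · exact Matrix.mulVec_injective_of_det_mem_nonZeroDivisors hdet'
    · intro x
      exact RingHom.map_mulVec B.subtype A x |> funext
  have h2 : (AddMonoidHom.mulLeft A.det).range.index =
      (AddMonoidHom.mulLeft A'.det).range.index := by
    refine aux_conj B.subtype.toAddMonoidHom _ _ Subtype.val_injective ?_ ?_ hi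
    · intro x y h
      have h' : A'.det * x = A'.det * y := h
      exact (mul_cancel_left_mem_nonZeroDivisors hdet').mp h'
    · intro x
      rw [hd]; rfl
  have h3 : Nat.card ((Fin m → B) ⧸ LinearMap.range (Matrix.mulVecLin A)) =
      A.mulVecLin.toAddMonoidHom.range.index := rfl
  have h4 : Nat.card (B ⧸ Ideal.span {A.det}) = (AddMonoidHom.mulLeft A.det).range.index := by
    have h : (AddMonoidHom.mulLeft A.det).range =
        Submodule.toAddSubgroup (Ideal.span {A.det}) := by
      ext x
      refine Iff.trans ?_ (Ideal.mem_span_singleton (x := x) (y := A.det)).symm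
      constructor
      · rintro ⟨y, rfl⟩; exact ⟨y, rfl⟩
      · rintro ⟨y, rfl⟩; exact ⟨y, rfl⟩
    rw [h]; rfl
  have key : Nat.card ((Fin m → B) ⧸ LinearMap.range (Matrix.mulVecLin A)) =
        Nat.card (B ⧸ Ideal.span {A.det}) := by
    rw [h3, h4, h1, h2, aux_pipid P A' hdet']
  refine ⟨Nat.finite_of_card_ne_zero ?_, key⟩
  rw [key]
  exact Nat.card_ne_zero.mpr ⟨⟨0⟩, hquot⟩
end

section
/- Let R be a commutative ring and let 0 → A → B → C → 0 and 0 → A' → B' → C → 0 be two short exact sequences of finitely presented R-modules with the same third term C, in which B and B' are quadratically presented. Then Fitt_R(A) · Fitt_R(B') = Fitt_R(A') · Fitt_R(B), where Fitt_R denotes the 0th Fitting ideal. -/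
/-- The 0th Fitting ideal of an `R`-module `M`: the ideal generated by the determinants of
all `n × n` matrices whose columns are relations for some surjection `R^n ↠ M`. -/
def fittingIdeal (R : Type*) [CommRing R] (M : Type*) [AddCommGroup M] [Module R M] :
    Ideal R :=
  Ideal.span { d : R | ∃ (n : ℕ) (π : (Fin n → R) →ₗ[R] M), Function.Surjective π ∧
    ∃ A : Matrix (Fin n) (Fin n) R, (∀ j, π (fun i => A i j) = 0) ∧ d = A.det }

/-- An `R`-module `M` is quadratically presented if there is an exact sequence
`R^m → R^m → M → 0` for some `m`. -/
def QuadraticallyPresented (R : Type*) [CommRing R] (M : Type*) [AddCommGroup M]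
    [Module R M] : Prop :=
  ∃ (m : ℕ) (f : (Fin m → R) →ₗ[R] (Fin m → R)) (g : (Fin m → R) →ₗ[R] M),
    Function.Surjective g ∧ LinearMap.range f = LinearMap.ker g

open Matrix in
theorem aux_laplace {R : Type*} [CommRing R] {n : ℕ} (K : Set (Fin n → R)) (I : Ideal R)
    (hI : ∀ A : Matrix (Fin n) (Fin n) R, (∀ j, (fun i => A i j) ∈ K) → A.det ∈ I) (k : ℕ) :
    ∀ M : Matrix (Fin (n + k)) (Fin (n + k)) R,
      (∀ j, (fun i : Fin n => M (Fin.castAdd k i) j) ∈ K) → M.det ∈ I := by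
  induction k with
  | zero => intro M hM; exact hI M hM
  | succ k ih =>
    intro M hM
    have := Matrix.det_succ_row (n := n + k) M (Fin.last (n + k))
    rw [this]
    refine Ideal.sum_mem _ fun j _ => Ideal.mul_mem_left _ _ (ih _ fun c => ?_)
    have h := hM (Fin.succAbove (n := n + k) j c)
    convert h using 2 with i
    rw [Matrix.submatrix_apply, Fin.succAbove_last]
    rfl

theorem aux_laplace_sum {R : Type*} [CommRing R] {n k : ℕ} (K : Set (Fin n → R)) (I : Ideal R)
    (hI : ∀ A : Matrix (Fin n) (Fin n) R, (∀ j, (fun i => A i j) ∈ K) → A.det ∈ I)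
    (M : Matrix (Fin n ⊕ Fin k) (Fin n ⊕ Fin k) R)
    (hM : ∀ j, (fun i : Fin n => M (Sum.inl i) j) ∈ K) : M.det ∈ I := by
  have := aux_laplace K I hI k (M.submatrix finSumFinEquiv.symm finSumFinEquiv.symm) (by
    intro j
    simpa using hM _)
  rwa [Matrix.det_submatrix_equiv_self] at this

theorem aux_lift {R : Type*} [CommRing R] {X : Type*} [AddCommGroup X] [Module R X]
    {n m : ℕ} (g : (Fin n → R) →ₗ[R] X) (h : (Fin m → R) →ₗ[R] X)
    (H : ∀ y, ∃ l, g l = h y) :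
    ∃ L : Matrix (Fin n) (Fin m) R, ∀ y, g (L.mulVec y) = h y := by
  choose l hl using H
  refine ⟨Matrix.of fun i j => l (Pi.single j 1) i, fun y => ?_⟩
  have : g ∘ₗ Matrix.mulVecLin (Matrix.of fun i j => l (Pi.single j 1) i) = h := by
    apply LinearMap.pi_ext'
    intro j
    ext
    have : (Matrix.of fun i j => l (Pi.single j 1) i).mulVec (Pi.single j 1)
        = l (Pi.single j 1) := by
      ext i; simp
    simp [this, hl, -Matrix.mulVec_single]
  exact LinearMap.congr_fun this y

open Matrix in
theorem aux_indep {R : Type*} [CommRing R] {M : Type*} [AddCommGroup M] [Module R M]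
    {n : ℕ} (π : (Fin n → R) →ₗ[R] M) (hπ : Function.Surjective π) (I : Ideal R)
    (hI : ∀ A : Matrix (Fin n) (Fin n) R, (∀ j, π (fun i => A i j) = 0) → A.det ∈ I) :
    fittingIdeal R M ≤ I := by
  refine Ideal.span_le.2 ?_
  rintro _ ⟨k, π', hπ', A', hA', rfl⟩
  obtain ⟨S, hS⟩ := aux_lift π' π (fun y => hπ' _)
  obtain ⟨T, hT⟩ := aux_lift π π' (fun y => hπ _)
  have hd : A'.det = (fromBlocks 1 T 0 1 * fromBlocks 1 0 (-S) A').det := by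
    rw [det_mul, det_fromBlocks_zero₂₁, det_fromBlocks_zero₁₂]; simp
  rw [hd]
  refine aux_laplace_sum {x | π x = 0} I hI _ ?_
  rintro (j | j)
  · have : (fun i : Fin n => (fromBlocks 1 T 0 1 * fromBlocks 1 0 (-S) A' :
        Matrix (Fin n ⊕ Fin k) (Fin n ⊕ Fin k) R) (Sum.inl i) (Sum.inl j))
       = Pi.single j 1 - T.mulVec (S.mulVec (Pi.single j 1)) := by
      ext i
      simp [Matrix.mul_apply, Matrix.one_apply, Pi.single_apply, mulVec,
        dotProduct, sub_eq_add_neg]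
    simp only [Set.mem_ofPred_eq, this, map_sub, hT, hS, sub_self]
  · have : (fun i : Fin n => (fromBlocks 1 T 0 1 * fromBlocks 1 0 (-S) A' :
        Matrix (Fin n ⊕ Fin k) (Fin n ⊕ Fin k) R) (Sum.inl i) (Sum.inr j))
       = T.mulVec (fun i => A' i j) := by
      ext i
      simp [Matrix.mul_apply, mulVec, dotProduct]
    simp only [Set.mem_ofPred_eq, this, hT, hA']

theorem aux_reindex {R : Type*} [CommRing R] {M : Type*} [AddCommGroup M] [Module R M]
    {n m : ℕ} (ρ : (Fin n ⊕ Fin m → R) →ₗ[R] M) (hρ : Function.Surjective ρ) :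
    ∃ π : (Fin (n + m) → R) →ₗ[R] M, Function.Surjective π ∧
      ∀ z, π z = ρ (fun i => z (finSumFinEquiv i)) := by
  refine ⟨ρ ∘ₗ LinearMap.funLeft R R finSumFinEquiv, ?_, fun z => rfl⟩
  rw [LinearMap.coe_comp]
  exact hρ.comp (LinearMap.funLeft_surjective_of_injective _ _ _ finSumFinEquiv.injective)

set_option maxHeartbeats 2000000 in
open Matrix in
theorem aux_ses {R : Type*} [CommRing R] {A X B : Type*}
    [AddCommGroup A] [Module R A] [AddCommGroup X] [Module R X] [AddCommGroup B] [Module R B]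
    [Module.Finite R A]
    (f : A →ₗ[R] X) (p : X →ₗ[R] B) (hf : Function.Injective f) (hp : Function.Surjective p)
    (hpf : ∀ a, p (f a) = 0) (hex : ∀ x, p x = 0 → ∃ a, f a = x)
    (hB : QuadraticallyPresented R B) :
    fittingIdeal R X = fittingIdeal R A * fittingIdeal R B := by
  -- the horseshoe surjection
  have horse : ∀ {n m : ℕ} (πA : (Fin n → R) →ₗ[R] A) (πB : (Fin m → R) →ₗ[R] B),
      Function.Surjective πA → Function.Surjective πB →
      ∃ (σ : (Fin m → R) →ₗ[R] X) (π : (Fin (n + m) → R) →ₗ[R] X), (∀ y, p (σ y) = πB y) ∧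
        Function.Surjective π ∧ ∀ z, π z = f (πA fun i => z (finSumFinEquiv (Sum.inl i)))
          + σ (fun i => z (finSumFinEquiv (Sum.inr i))) := by
    intro n m πA πB hA hB
    obtain ⟨σ, hσ⟩ := Module.projective_lifting_property p πB hp
    have hσ' : ∀ y, p (σ y) = πB y := fun y => LinearMap.congr_fun hσ y
    obtain ⟨π, h1, h2⟩ := aux_reindex (n := n) (m := m)
      ((f ∘ₗ πA ∘ₗ LinearMap.funLeft R R Sum.inl) + σ ∘ₗ LinearMap.funLeft R R Sum.inr) (by
        intro x
        obtain ⟨y, hy⟩ := hB (p x)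
        obtain ⟨a, ha⟩ := hex (x - σ y) (by rw [map_sub, hσ', hy, sub_self])
        obtain ⟨u, rfl⟩ := hA a
        refine ⟨Sum.elim u y, ?_⟩
        have e1 : LinearMap.funLeft R R Sum.inl (Sum.elim u y) = u := rfl
        have e2 : LinearMap.funLeft R R Sum.inr (Sum.elim u y) = y := rfl
        simp [e1, e2, ha])
    exact ⟨σ, π, hσ', h1, h2⟩
  apply le_antisymm
  · obtain ⟨n, πA, hA⟩ := Module.Finite.exists_fin' R A
    obtain ⟨m, P, πB, hB, hP⟩ := hB
    obtain ⟨σ, π, hσ, hπ, hz⟩ := horse πA πB hA hB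
    have hPB : ∀ y, πB (P y) = 0 := fun y => by
      have : P y ∈ LinearMap.ker πB := hP ▸ LinearMap.mem_range_self P y
      exact this
    have hBP : ∀ y, πB y = 0 → ∃ q, P q = y := fun y hy => by
      have : y ∈ LinearMap.range P := by rw [hP]; exact hy
      exact this
    obtain ⟨L, hL⟩ := aux_lift (f ∘ₗ πA) (-(σ ∘ₗ P)) (fun y => by
      obtain ⟨a, ha⟩ := hex (-(σ (P y))) (by rw [map_neg, hσ, hPB, neg_zero])
      obtain ⟨u, rfl⟩ := hA a
      exact ⟨u, ha⟩)
    simp only [LinearMap.comp_apply, LinearMap.neg_apply] at hL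
    refine aux_indep π hπ _ ?_
    intro M' hM'
    let M : Matrix (Fin n ⊕ Fin m) (Fin n ⊕ Fin m) R :=
      M'.submatrix finSumFinEquiv finSumFinEquiv
    have hdet : M'.det = M.det := (det_submatrix_equiv_self _ _).symm
    have hM : ∀ j, f (πA fun i => M (Sum.inl i) j) + σ (fun i => M (Sum.inr i) j) = 0 := by
      intro j
      rw [← hM' (finSumFinEquiv j), hz]; rfl
    have hq : ∀ j, ∃ q, P q = fun i => M (Sum.inr i) j := fun j => hBP _ (by
      have := congrArg p (hM j)
      simpa [hpf, hσ] using this)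
    choose q hq using hq
    let Q : Matrix (Fin m) (Fin n ⊕ Fin m) R := Matrix.of fun i j => q j i
    let Y : Matrix (Fin n) (Fin n ⊕ Fin m) R := Matrix.of fun i j => M (Sum.inl i) j - (L *ᵥ q j) i
    have hMf : M = fromBlocks 1 L 0 (LinearMap.toMatrix' P) * fromRows Y Q := by
      rw [fromBlocks_mul_fromRows]
      ext i j
      rcases i with i | i
      · simp [Y, Q, Matrix.mul_apply, mulVec, dotProduct]
      · have h1 := congrFun (hq j) i
        rw [← LinearMap.toMatrix'_mulVec P (q j)] at h1
        simp only [fromRows_apply_inr, Matrix.zero_mul, zero_add]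
        rw [← h1]
        rfl
    rw [hdet, hMf, det_mul, det_fromBlocks_zero₂₁, det_one, one_mul, mul_comm (det _)]
    refine Ideal.mul_mem_mul ?_ ?_
    · refine aux_laplace_sum {x | πA x = 0} _ ?_ _ ?_
      · intro U hU
        exact Ideal.subset_span ⟨n, πA, hA, U, hU, rfl⟩
      · intro j
        apply hf
        have e : (fun i => fromRows Y Q (Sum.inl i) j) = (fun i => M (Sum.inl i) j) - L *ᵥ q j := by
          ext i; simp [Y]
        rw [e, map_sub, map_sub, hL, hq, map_zero, sub_neg_eq_add, hM]
    · refine Ideal.subset_span ⟨m, πB, hB, LinearMap.toMatrix' P, fun j => ?_, rfl⟩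
      have e : (fun i => LinearMap.toMatrix' P i j) = P (Pi.single j 1) := by
        ext i; simp [LinearMap.toMatrix'_apply]
      rw [e, hPB]
  · unfold fittingIdeal
    rw [Ideal.span_mul_span', Ideal.span_le]
    rintro _ ⟨_, ⟨n, πA, hA, U, hU, rfl⟩, _, ⟨m, πB, hB, V, hV, rfl⟩, rfl⟩
    obtain ⟨σ, π, hσ, hπ, hz⟩ := horse πA πB hA hB
    have hL : ∀ j, ∃ l, f (πA l) = -σ (fun i => V i j) := fun j => by
      obtain ⟨a, ha⟩ := hex (-σ (fun i => V i j)) (by rw [map_neg, hσ, hV, neg_zero])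
      obtain ⟨u, rfl⟩ := hA a
      exact ⟨u, ha⟩
    choose l hl using hL
    refine Ideal.subset_span ⟨n + m, π, hπ,
      (fromBlocks U (Matrix.of fun i j => l j i) 0 V).submatrix
        finSumFinEquiv.symm finSumFinEquiv.symm, ?_, ?_⟩
    · intro j
      obtain ⟨j, rfl⟩ := finSumFinEquiv.surjective j
      rw [hz]
      simp only [submatrix_apply, Equiv.symm_apply_apply]
      rcases j with j | j
      · simp only [fromBlocks_apply₁₁, fromBlocks_apply₂₁, hU, Matrix.zero_apply, map_zero,
          zero_add]
        exact map_zero σ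
      · simp only [fromBlocks_apply₁₂, fromBlocks_apply₂₂, Matrix.of_apply]
        rw [hl, neg_add_cancel]
    · rw [det_submatrix_equiv_self, det_fromBlocks_zero₂₁]

/-- Given two short exact sequences `0 → A → B → C → 0` and `0 → A' → B' → C → 0` of finitely
presented `R`-modules with `B`, `B'` quadratically presented, one has
`Fitt(A) · Fitt(B') = Fitt(A') · Fitt(B)`. -/
theorem stmt_3 {R : Type*} [CommRing R]
    {A B A' B' C : Type*}
    [AddCommGroup A] [Module R A] [AddCommGroup B] [Module R B]
    [AddCommGroup A'] [Module R A'] [AddCommGroup B'] [Module R B']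
    [AddCommGroup C] [Module R C]
    [Module.FinitePresentation R A] [Module.FinitePresentation R B]
    [Module.FinitePresentation R A'] [Module.FinitePresentation R B']
    [Module.FinitePresentation R C]
    (f : A →ₗ[R] B) (g : B →ₗ[R] C)
    (hf : Function.Injective f) (hg : Function.Surjective g)
    (hfg : LinearMap.range f = LinearMap.ker g)
    (f' : A' →ₗ[R] B') (g' : B' →ₗ[R] C)
    (hf' : Function.Injective f') (hg' : Function.Surjective g')
    (hfg' : LinearMap.range f' = LinearMap.ker g')
    (hB : QuadraticallyPresented R B) (hB' : QuadraticallyPresented R B') :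
    fittingIdeal R A * fittingIdeal R B' = fittingIdeal R A' * fittingIdeal R B := by
  let X := LinearMap.eqLocus (g ∘ₗ LinearMap.fst R B B') (g' ∘ₗ LinearMap.snd R B B')
  have gf : ∀ a, g (f a) = 0 := fun a => by
    have : f a ∈ LinearMap.ker g := hfg ▸ LinearMap.mem_range_self f a
    exact this
  have gf' : ∀ a, g' (f' a) = 0 := fun a => by
    have : f' a ∈ LinearMap.ker g' := hfg' ▸ LinearMap.mem_range_self f' a
    exact this
  have ex : ∀ x, g x = 0 → ∃ a, f a = x := fun x hx => by
    have : x ∈ LinearMap.range f := by rw [hfg]; exact hx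
    exact this
  have ex' : ∀ x, g' x = 0 → ∃ a, f' a = x := fun x hx => by
    have : x ∈ LinearMap.range f' := by rw [hfg']; exact hx
    exact this
  have hX : ∀ x : X, g x.1.1 = g' x.1.2 := fun x => x.2
  have h1 : fittingIdeal R X = fittingIdeal R A * fittingIdeal R B' := by
    refine aux_ses ((LinearMap.inl R B B' ∘ₗ f).codRestrict X fun a => ?_)
      (LinearMap.snd R B B' ∘ₗ X.subtype) ?_ ?_ ?_ ?_ hB'
    · change g (f a) = g' 0
      rw [gf, map_zero]
    · intro a b hab
      exact hf (congrArg (fun x : X => x.1.1) hab)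
    · intro b
      obtain ⟨c, hc⟩ := hg (g' b)
      exact ⟨⟨(c, b), hc⟩, rfl⟩
    · intro a
      rfl
    · intro x hx
      have hx' : x.1.2 = 0 := hx
      obtain ⟨a, ha⟩ := ex x.1.1 (by rw [hX, hx', map_zero])
      exact ⟨a, Subtype.ext (Prod.ext ha hx'.symm)⟩
  have h2 : fittingIdeal R X = fittingIdeal R A' * fittingIdeal R B := by
    refine aux_ses ((LinearMap.inr R B B' ∘ₗ f').codRestrict X fun a => ?_)
      (LinearMap.fst R B B' ∘ₗ X.subtype) ?_ ?_ ?_ ?_ hB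
    · change g 0 = g' (f' a)
      rw [gf', map_zero]
    · intro a b hab
      exact hf' (congrArg (fun x : X => x.1.2) hab)
    · intro b
      obtain ⟨c, hc⟩ := hg' (g b)
      exact ⟨⟨(b, c), hc.symm⟩, rfl⟩
    · intro a
      rfl
    · intro x hx
      have hx' : x.1.1 = 0 := hx
      obtain ⟨a, ha⟩ := ex' x.1.2 (by rw [← hX, hx', map_zero])
      exact ⟨a, Subtype.ext (Prod.ext hx'.symm ha)⟩
  rw [← h1, h2]
end

section
/- Let R be a commutative ring, M a finitely presented R-module, N ⊆ M a finitely generated submodule, and r a positive integer. Then the 0th Fitting ideal Fitt_R(M/N) annihilates the cokernel of the canonical map ⋀^r_R N → ⋀^r_R M of r-th exterior powers induced by the inclusion N ⊆ M; that is, for every ξ ∈ Fitt_R(M/N) and every ω ∈ ⋀^r_R M, the element ξ·ω lies in the image of ⋀^r_R N → ⋀^r_R M. -/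
open ExteriorAlgebra in
theorem aux_contract {R F : Type*} [CommRing R] [AddCommGroup F] [Module R F]
    (P : Submodule R F) (φ : Module.Dual R F) (k : ℕ) :
    ∀ x ∈ (P.map (ι R)) ^ (k + 1),
      CliffordAlgebra.contractLeft (Q := (0 : QuadraticForm R F)) φ x ∈ (P.map (ι R)) ^ k := by
  induction k with
  | zero =>
    intro x hx
    rw [zero_add, pow_one] at hx
    obtain ⟨p, hp, rfl⟩ := hx
    have := CliffordAlgebra.contractLeft_ι (Q := (0 : QuadraticForm R F)) φ p
    rw [pow_zero]
    erw [this]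
    exact Submodule.algebraMap_mem _
  | succ k ih =>
    intro x hx
    rw [pow_succ'] at hx
    refine Submodule.mul_induction_on hx ?_ ?_
    · rintro _ ⟨p, hp, rfl⟩ b hb
      have := CliffordAlgebra.contractLeft_ι_mul (Q := (0 : QuadraticForm R F)) φ p b
      erw [this]
      refine Submodule.sub_mem _ (Submodule.smul_mem _ _ hb) ?_
      rw [pow_succ']
      exact Submodule.mul_mem_mul ⟨p, hp, rfl⟩ (ih b hb)
    · intro a b ha hb
      rw [map_add]
      exact Submodule.add_mem _ ha hb

theorem aux_alt {R M N ι : Type*} [CommRing R] [AddCommGroup M] [Module R M]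
    [AddCommGroup N] [Module R N] [Fintype ι] [DecidableEq ι]
    (e : Module.Basis ι R M) (f : M [⋀^ι]→ₗ[R] N) (v : ι → M) : f v = e.det v • f e := by
  have : f = (LinearMap.toSpanSingleton R N (f e)).compAlternatingMap e.det := by
    refine Module.Basis.ext_alternating e fun i h => ?_
    let σ : Equiv.Perm ι := Equiv.ofBijective i (Finite.injective_iff_bijective.1 h)
    change f (e ∘ σ) = (LinearMap.toSpanSingleton R N (f e)).compAlternatingMap e.det (e ∘ σ)
    rw [AlternatingMap.map_perm, AlternatingMap.map_perm]
    simp [Module.Basis.det_self]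
  conv_lhs => rw [this]
  simp

open ExteriorAlgebra in
theorem aux_mem {R M : Type*} [CommRing R] [AddCommGroup M] [Module R M] (P : Submodule R M)
    (s : ℕ) (v : Fin s → M) (hv : ∀ i, v i ∈ P) : ιMulti R s v ∈ (P.map (ι R)) ^ s := by
  induction s with
  | zero => rw [ιMulti_zero_apply, pow_zero]; exact Submodule.one_le.mp le_rfl
  | succ s ih =>
    rw [ιMulti_succ_apply, pow_succ']
    exact Submodule.mul_mem_mul ⟨_, hv 0, rfl⟩ (ih _ fun i => hv _)

open ExteriorAlgebra in
theorem aux_basis {R F : Type*} [CommRing R] [AddCommGroup F] [Module R F] {n : ℕ}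
    (e : Module.Basis (Fin n) R F) (P : Submodule R F) (s : ℕ) (d : R)
    (h : ∀ v : Fin s → Fin n, d • ιMulti R s (fun i => e (v i)) ∈ P.map (ι R) ^ s) :
    ∀ z ∈ ⋀[R]^s F, d • z ∈ P.map (ι R) ^ s := by
  intro z hz
  rw [← exteriorPower.ιMulti_span_fixedDegree_of_span_eq_top R s F e.span_eq] at hz
  induction hz using Submodule.span_induction with
  | mem x hx =>
    obtain ⟨a, ha, rfl⟩ := hx
    choose v hv using fun i => ha ⟨i, rfl⟩
    have : a = fun i => e (v i) := funext fun i => (hv i).symm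
    rw [this]; exact h v
  | zero => simp
  | add x y _ _ hx hy => rw [smul_add]; exact Submodule.add_mem _ hx hy
  | smul a x _ hx => rw [smul_comm]; exact Submodule.smul_mem _ _ hx

open ExteriorAlgebra in
theorem aux_zero {R F : Type*} [CommRing R] [AddCommGroup F] [Module R F]
    (φ : Module.Dual R F) (s : ℕ) (v : Fin s → F) (h : ∀ i, φ (v i) = 0) :
    CliffordAlgebra.contractLeft (Q := (0 : QuadraticForm R F)) φ (ιMulti R s v) = 0 := by
  induction s with
  | zero =>
    rw [ιMulti_zero_apply]
    exact CliffordAlgebra.contractLeft_one (Q := (0 : QuadraticForm R F)) φ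
  | succ s ih =>
    rw [ιMulti_succ_apply]
    have := CliffordAlgebra.contractLeft_ι_mul (Q := (0 : QuadraticForm R F)) φ (v 0)
      (ιMulti R s (Matrix.vecTail v))
    erw [this, ih _ fun i => h _, h 0]
    simp

open ExteriorAlgebra in
theorem aux_free {R F : Type*} [CommRing R] [AddCommGroup F] [Module R F] {n : ℕ}
    (e : Module.Basis (Fin n) R F) (P : Submodule R F) (y : Fin n → F) (hy : ∀ i, y i ∈ P)
    (s : ℕ) : ∀ z ∈ ⋀[R]^s F, e.det y • z ∈ P.map (ι R) ^ s := by
  have top : ∀ z ∈ ⋀[R]^n F, e.det y • z ∈ P.map (ι R) ^ n := by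
    apply aux_basis e
    intro v
    rw [aux_alt e (ιMulti R n) (fun i => e (v i)), smul_comm, ← aux_alt e (ιMulti R n) y]
    exact Submodule.smul_mem _ _ (aux_mem P n y hy)
  rcases le_or_gt s n with hs | hs
  · induction hs using Nat.decreasingInduction with
    | self => exact top
    | of_succ s hs ih =>
      apply aux_basis e
      intro v
      obtain ⟨i, hi⟩ : ∃ i, ∀ j, v j ≠ i := by
        by_contra hcon
        push Not at hcon
        have := Fintype.card_le_of_surjective v hcon
        simp at this
        omega
      have h1 := ih (ι R (e i) * ιMulti R s (fun j => e (v j))) (by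
        change _ ∈ (LinearMap.range (ι R)) ^ (s + 1)
        rw [pow_succ']
        exact Submodule.mul_mem_mul ⟨_, rfl⟩ (ιMulti_range R s ⟨_, rfl⟩))
      have h2 := aux_contract P (e.coord i) s _ h1
      have h3 := CliffordAlgebra.contractLeft_ι_mul (Q := (0 : QuadraticForm R F)) (e.coord i)
        (e i) (ιMulti R s (fun j => e (v j)))
      erw [map_smul, h3, aux_zero (e.coord i) s _ (fun j => by
        simp [Finsupp.single_apply, hi j])] at h2
      simpa using h2
  · apply aux_basis e
    intro v
    rw [ιMulti_eq_zero_of_not_inj]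
    · simp
    · intro hinj
      have := Fintype.card_le_of_injective v (fun a b hab => hinj (by simp [hab]))
      simp at this
      omega

open ExteriorAlgebra in
theorem aux_comm {R M : Type*} [CommRing R] [AddCommGroup M] [Module R M] (P Q : Submodule R M) :
    P.map (ι R) * Q.map (ι R) ≤ Q.map (ι R) * P.map (ι R) := by
  rw [Submodule.mul_le]
  rintro _ ⟨p, hp, rfl⟩ _ ⟨q, hq, rfl⟩
  rw [eq_neg_of_add_eq_zero_left (ι_add_mul_swap p q)]
  exact Submodule.neg_mem _ (Submodule.mul_mem_mul ⟨q, hq, rfl⟩ ⟨p, hp, rfl⟩)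

theorem aux_mix {R A : Type*} [CommRing R] [Ring A] [Algebra R A] (N X : Submodule R A)
    (hc : Commute X N) (d : R) (h : ∀ j, ∀ z ∈ X ^ j, d • z ∈ N ^ j) (s : ℕ) :
    ∀ j, X ^ j * (N ⊔ X) ^ s ≤ (N ^ (j + s)).comap (d • LinearMap.id) := by
  induction s with
  | zero => intro j z hz; simpa using h j z (by simpa using hz)
  | succ s ih =>
    intro j
    rw [pow_succ', Submodule.sup_mul, Submodule.mul_sup, ← mul_assoc, ← mul_assoc, ← pow_succ,
      (hc.pow_left j).eq]
    refine sup_le ?_ ?_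
    · rw [mul_assoc, Submodule.mul_le]
      intro a ha b hb
      have := ih j hb
      simp only [Submodule.mem_comap, LinearMap.smul_apply, LinearMap.id_apply] at this ⊢
      rw [← mul_smul_comm, ← add_assoc, pow_succ']
      exact Submodule.mul_mem_mul ha this
    · have := ih (j + 1)
      rwa [show j + 1 + s = j + (s + 1) by omega] at this

/-- Let `M` be a finitely presented `R`-module, `N ⊆ M` a finitely generated submodule and
`r > 0`.  Then `Fitt_R(M/N)` annihilates the cokernel of the canonical map
`⋀^r N → ⋀^r M`: for `ξ ∈ Fitt_R(M/N)` and `ω ∈ ⋀^r M`, the element `ξ • ω` lies in the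
image of `⋀^r N` in `⋀^r M` (via the map induced by the inclusion `N ⊆ M`). -/
theorem stmt_4 {R M : Type*} [CommRing R] [AddCommGroup M] [Module R M]
    [Module.FinitePresentation R M]
    (N : Submodule R M) (hN : N.FG) {r : ℕ} (hr : 0 < r)
    (ξ : R) (hξ : ξ ∈ fittingIdeal R (M ⧸ N))
    (ω : ExteriorAlgebra R M) (hω : ω ∈ ⋀[R]^r M) :
    ξ • ω ∈ Submodule.map (ExteriorAlgebra.map N.subtype).toLinearMap (⋀[R]^r ↥N) := by
  rw [ExteriorAlgebra.exteriorPower, Submodule.map_pow, ExteriorAlgebra.ι_range_map_map, Submodule.range_subtype]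
  induction hξ using Submodule.span_induction with
  | zero => simp
  | add x y _ _ hx hy => rw [add_smul]; exact Submodule.add_mem _ hx hy
  | smul a x _ hx => rw [smul_assoc]; exact Submodule.smul_mem _ _ hx
  | mem d hd =>
    obtain ⟨n, π, hπ, A, hA, rfl⟩ := hd
    choose x hx using fun i : Fin n => N.mkQ_surjective (π (Pi.single i 1))
    let e := Pi.basisFun R (Fin n)
    let g : (Fin n → R) →ₗ[R] M := e.constr R x
    have hg : N.mkQ ∘ₗ g = π := by
      apply e.ext
      intro i
      simp only [LinearMap.comp_apply, g, Module.Basis.constr_basis, hx]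
      simp [e]
    have hsup : N ⊔ LinearMap.range g = ⊤ := by
      rw [eq_top_iff]
      intro m _
      obtain ⟨f, hf⟩ := hπ (N.mkQ m)
      rw [← hg, LinearMap.comp_apply] at hf
      have : m - g f ∈ N := by
        rw [← Submodule.ker_mkQ N, LinearMap.mem_ker, map_sub, hf, sub_self]
      rw [← sub_add_cancel m (g f)]
      exact Submodule.add_mem_sup this ⟨f, rfl⟩
    have hP : ∀ j, (fun i => A i j) ∈ N.comap g := by
      intro j
      have := hA j
      rw [← hg, LinearMap.comp_apply] at this
      rwa [← LinearMap.mem_ker, Submodule.ker_mkQ] at this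
    have hdet : e.det (fun j i => A i j) = A.det := by
      rw [Module.Basis.det_apply]
      congr 1
    have key := aux_mix (N.map (ExteriorAlgebra.ι R)) ((LinearMap.range g).map (ExteriorAlgebra.ι R))
      (le_antisymm (aux_comm _ _) (aux_comm _ _)) A.det (by
        intro j z hz
        rw [← ExteriorAlgebra.ι_range_map_map, ← Submodule.map_pow] at hz
        obtain ⟨w, hw, rfl⟩ := hz
        have h1 := aux_free e (N.comap g) _ hP j w hw
        rw [hdet] at h1
        have h2 : ExteriorAlgebra.map g (A.det • w) ∈
            Submodule.map (ExteriorAlgebra.map g).toLinearMap _ := ⟨_, h1, rfl⟩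
        rw [Submodule.map_pow, ← Submodule.map_comp, ExteriorAlgebra.map_comp_ι, Submodule.map_comp] at h2
        rw [map_smul] at h2
        exact pow_le_pow_left'
          (Submodule.map_mono (Submodule.map_comap_le g N)) j h2) r 0
    rw [pow_zero, one_mul, ← Submodule.map_sup, hsup, Submodule.map_top, zero_add] at key
    exact key hω
end

section
/- Let Γ be a group, Δ ⊴ Γ a normal subgroup such that the quotient G = Γ/Δ is finite abelian, and let N be an abelian group on which multiplication by 2 is bijective, equipped with a G-action (hence a Γ-action through the projection Γ → G, with Δ acting trivially). Suppose some σ ∈ G acts on N as multiplication by −1. Then the restriction map in group cohomology gives a bijection from H^1(Γ, N) onto the set of group homomorphisms f : Δ → N satisfying f(γ δ γ⁻¹) = γ̄ · f(δ) for all γ ∈ Γ and δ ∈ Δ, where γ̄ denotes the image of γ in G. (Since Δ acts trivially on N, H^1(Δ, N) is the group Hom(Δ, N), and the condition singles out its G-invariant elements for the conjugation action.) -/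
/-- Let `Δ ⊴ Γ` with `G = Γ/Δ` finite abelian, and let `N` be an abelian group with a
`G`-action (hence a `Γ`-action through the projection) on which doubling is bijective and
some `σ ∈ G` acts as `-1`.  Then restriction of 1-cocycles gives a bijection from
`H¹(Γ, N)` onto the set of homomorphisms `f : Δ → N` with `f(γδγ⁻¹) = γ̄ • f(δ)`:
(i) restriction of a cocycle is such an equivariant homomorphism, (ii) two cocycles with
the same restriction differ by a coboundary, (iii) every equivariant homomorphism is the
restriction of a cocycle. -/
theorem stmt_5 {Γ : Type*} [Group Γ] (Δ : Subgroup Γ) [hΔ : Δ.Normal]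
    [Finite (Γ ⧸ Δ)] (hab : ∀ a b : Γ ⧸ Δ, a * b = b * a)
    {N : Type*} [AddCommGroup N] [DistribMulAction (Γ ⧸ Δ) N]
    (h2 : Function.Bijective (fun n : N => n + n))
    (σ : Γ ⧸ Δ) (hσ : ∀ n : N, σ • n = -n) :
    (∀ c : Γ → N, (∀ γ γ' : Γ, c (γ * γ') = c γ + (γ : Γ ⧸ Δ) • c γ') →
        (∀ δ δ' : Δ, c ((δ : Γ) * (δ' : Γ)) = c (δ : Γ) + c (δ' : Γ)) ∧
        (∀ (γ : Γ) (δ : Δ), c (γ * (δ : Γ) * γ⁻¹) = (γ : Γ ⧸ Δ) • c (δ : Γ)))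
    ∧ (∀ c c' : Γ → N, (∀ γ γ' : Γ, c (γ * γ') = c γ + (γ : Γ ⧸ Δ) • c γ') →
        (∀ γ γ' : Γ, c' (γ * γ') = c' γ + (γ : Γ ⧸ Δ) • c' γ') →
        (∀ δ : Δ, c (δ : Γ) = c' (δ : Γ)) →
        ∃ n : N, ∀ γ : Γ, c γ - c' γ = (γ : Γ ⧸ Δ) • n - n)
    ∧ (∀ f : Δ → N, (∀ δ δ' : Δ, f (δ * δ') = f δ + f δ') →
        (∀ (γ : Γ) (δ : Δ),
          f ⟨γ * (δ : Γ) * γ⁻¹, hΔ.conj_mem (δ : Γ) δ.2 γ⟩ = (γ : Γ ⧸ Δ) • f δ) →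
        ∃ c : Γ → N, (∀ γ γ' : Γ, c (γ * γ') = c γ + (γ : Γ ⧸ Δ) • c γ') ∧
          ∀ δ : Δ, c (δ : Γ) = f δ) := by
  have hone : ∀ δ : Δ, ((δ : Γ) : Γ ⧸ Δ) = 1 := fun δ =>
    (QuotientGroup.eq_one_iff (δ : Γ)).2 δ.2
  obtain ⟨s, rfl⟩ := QuotientGroup.mk_surjective σ
  have hcomm : ∀ γ : Γ, s * γ * s⁻¹ * γ⁻¹ ∈ Δ := by
    intro γ
    rw [← QuotientGroup.eq_one_iff]
    simp only [QuotientGroup.mk_mul, QuotientGroup.mk_inv]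
    rw [hab (s : Γ ⧸ Δ) γ]
    group
  have hinj : ∀ a b : N, a + a = b + b → a = b := fun a b h => h2.1 h
  refine ⟨?_, ?_, ?_⟩
  · intro c hc
    refine ⟨fun δ δ' => by rw [hc, hone, one_smul], fun γ δ => ?_⟩
    have h1 := hc (γ * δ * γ⁻¹) γ
    have h3 : γ * (δ : Γ) * γ⁻¹ * γ = γ * δ := by group
    have h4 := hone ⟨γ * (δ : Γ) * γ⁻¹, hΔ.conj_mem (δ : Γ) δ.2 γ⟩
    simp only at h4
    rw [h3, hc, h4, one_smul, add_comm] at h1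
    exact (add_right_cancel h1).symm
  · intro c c' hc hc' hcc
    have key : ∀ c : Γ → N, (∀ γ γ' : Γ, c (γ * γ') = c γ + (γ : Γ ⧸ Δ) • c γ') →
        ∀ γ, c s - c γ = c (s * γ * s⁻¹ * γ⁻¹) + (c γ + (γ : Γ ⧸ Δ) • c s) := by
      intro c hc γ
      have h3 : s * γ = (s * γ * s⁻¹ * γ⁻¹) * (γ * s) := by group
      have h4 := hone ⟨_, hcomm γ⟩
      simp only at h4
      have h5 := congrArg c h3
      rw [hc (s * γ * s⁻¹ * γ⁻¹) (γ * s), hc s γ, hσ, h4, one_smul, hc γ s] at h5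
      rw [sub_eq_add_neg, h5]
    obtain ⟨n, hn⟩ := h2.2 (-(c s - c' s))
    simp only at hn
    refine ⟨n, fun γ => hinj _ _ ?_⟩
    have k1 := key c hc γ
    have k2 := key c' hc' γ
    have k3 := hcc ⟨_, hcomm γ⟩
    simp only at k3
    have k4 := congrArg (fun x => (γ : Γ ⧸ Δ) • x) hn
    simp only [smul_add, smul_neg, smul_sub] at k4
    rw [k3] at k1
    have e : (γ : Γ ⧸ Δ) • n - n + ((γ : Γ ⧸ Δ) • n - n)
      = ((γ : Γ ⧸ Δ) • n + (γ : Γ ⧸ Δ) • n) - (n + n) := by abel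
    rw [e, k4, hn]
    have k5 : (γ : Γ ⧸ Δ) • c s = c s - c γ - c' (s * γ * s⁻¹ * γ⁻¹) - c γ := by
      rw [k1]; abel
    have k6 : (γ : Γ ⧸ Δ) • c' s = c' s - c' γ - c' (s * γ * s⁻¹ * γ⁻¹) - c' γ := by
      rw [k2]; abel
    rw [k5, k6]; abel
  · intro f hf hfe
    choose c hc using fun γ : Γ => h2.2 (-f ⟨_, hcomm γ⟩)
    simp only at hc
    refine ⟨c, fun γ γ' => hinj _ _ ?_, fun δ => hinj _ _ ?_⟩
    · have e : c γ + (γ : Γ ⧸ Δ) • c γ' + (c γ + (γ : Γ ⧸ Δ) • c γ')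
        = (c γ + c γ) + (γ : Γ ⧸ Δ) • (c γ' + c γ') := by rw [smul_add]; abel
      rw [e, hc, hc, hc, smul_neg, ← hfe, ← neg_add, ← hf]
      congr 2
      apply Subtype.ext
      simp only [Subgroup.coe_mul]
      group
    · have h0 : f 1 = 0 := by simpa using hf 1 1
      have hi : f δ⁻¹ = - f δ := by
        have := hf δ⁻¹ δ
        rw [inv_mul_cancel, h0] at this
        exact eq_neg_of_add_eq_zero_left this.symm
      have e : (⟨_, hcomm δ⟩ : Δ) = ⟨s * (δ : Γ) * s⁻¹, hΔ.conj_mem (δ : Γ) δ.2 s⟩ * δ⁻¹ :=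
        Subtype.ext (by simp)
      rw [hc, e, hf, hfe, hσ, hi]
      abel
end

section
/- Let p be a prime and let R be a commutative ℤ_p-algebra that is finitely generated as a ℤ_p-module. If x ∈ R is a non-zerodivisor, then for all sufficiently large positive integers m one has p^m ∈ xR; that is, x divides p^m in R. -/
/-- Let `p` be a prime and `R` a commutative `ℤ_p`-algebra that is finitely generated as a
`ℤ_p`-module.  If `x ∈ R` is a non-zerodivisor then `x` divides `p^m` in `R` for all
sufficiently large `m`. -/
theorem stmt_7 (p : ℕ) [Fact p.Prime] {R : Type*} [CommRing R] [Algebra ℤ_[p] R]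
    [Module.Finite ℤ_[p] R] (x : R) (hx : x ∈ nonZeroDivisors R) :
    ∃ M : ℕ, ∀ m : ℕ, M ≤ m → (p : R) ^ m ∈ Ideal.span {x} := by
  obtain ⟨f, hf, hfx⟩ := Algebra.IsIntegral.isIntegral (R := ℤ_[p]) x
  rw [← Polynomial.aeval_def] at hfx
  obtain ⟨g, hg, hnd⟩ :=
    Polynomial.exists_eq_pow_rootMultiplicity_mul_and_not_dvd f hf.ne_zero 0
  rw [Polynomial.C_0, sub_zero] at hg hnd
  rw [Polynomial.X_dvd_iff] at hnd
  rw [hg, map_mul, map_pow, Polynomial.aeval_X, mul_comm] at hfx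
  have hgx : Polynomial.aeval x g = 0 :=
    (mul_right_mem_nonZeroDivisors_eq_zero_iff (pow_mem hx _)).1 hfx
  have hdvd : x ∣ algebraMap ℤ_[p] R (g.coeff 0) := by
    rw [← Polynomial.divX_mul_X_add g, map_add, map_mul, Polynomial.aeval_X,
      Polynomial.aeval_C] at hgx
    exact ⟨-Polynomial.aeval x g.divX, by linear_combination hgx⟩
  refine ⟨(g.coeff 0).valuation, fun m hm => ?_⟩
  rw [Ideal.mem_span_singleton]
  refine dvd_trans ?_ (pow_dvd_pow (p : R) hm)
  rw [PadicInt.unitCoeff_spec hnd, map_mul, map_pow, map_natCast] at hdvd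
  exact ((PadicInt.unitCoeff hnd).isUnit.map (algebraMap ℤ_[p] R)).dvd_mul_left.1 hdvd
end

section
/- Let O be an infinite integral domain, and for j = 1, …, n let E_j be a field equipped with an injective ring homomorphism O → E_j. Let B be a finitely generated O-submodule of the product ring K = E_1 × ⋯ × E_n whose projection to each factor E_j is nonzero. Then B can be generated over O by finitely many elements b_1, …, b_m each of which has nonzero component in every factor E_j (equivalently, each b_i is a unit, hence a non-zerodivisor, of the ring K). -/
theorem aux_c {O : Type*} [CommRing O] [IsDomain O] [Infinite O]
    {n : ℕ} {E : Fin n → Type*} [∀ j, Field (E j)] [∀ j, Algebra O (E j)]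
    (hinj : ∀ j, Function.Injective (algebraMap O (E j))) (u v : ∀ j, E j) :
    ∃ c : O, ∀ j, (v j ≠ 0 ∨ u j ≠ 0) → (u + c • v) j ≠ 0 := by
  have hfin : (⋃ j : Fin n, {c : O | v j ≠ 0 ∧ u j + c • v j = 0}).Finite := by
    refine Set.finite_iUnion fun j => Set.Subsingleton.finite ?_
    rintro a ⟨hv, ha⟩ b ⟨_, hb⟩
    apply hinj j
    rw [Algebra.smul_def] at ha hb
    exact mul_right_cancel₀ hv (add_left_cancel (ha.trans hb.symm))
  obtain ⟨c, hc⟩ := hfin.exists_notMem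
  refine ⟨c, fun j hj h0 => ?_⟩
  simp only [Set.mem_iUnion, Set.mem_setOf_eq, not_exists, not_and] at hc
  by_cases hv : v j = 0
  · simp [hv] at hj h0
    exact hj h0
  · exact hc j hv h0

/-- Let `O` be an infinite integral domain and `E j` fields with injective ring maps
`O → E j`.  A finitely generated `O`-submodule `B` of `K = ∏ j, E j` with nonzero
projection to every factor is generated by finitely many elements all of whose components
are nonzero (i.e. by units of `K`). -/
theorem stmt_9 {O : Type*} [CommRing O] [IsDomain O] [Infinite O]
    {n : ℕ} {E : Fin n → Type*} [∀ j, Field (E j)] [∀ j, Algebra O (E j)]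
    (hinj : ∀ j, Function.Injective (algebraMap O (E j)))
    (B : Submodule O (∀ j, E j)) (hB : B.FG)
    (hproj : ∀ j, ∃ b ∈ B, b j ≠ 0) :
    ∃ (m : ℕ) (b : Fin m → (∀ j, E j)),
      (∀ i, b i ∈ B) ∧ (∀ i j, b i j ≠ 0) ∧
      Submodule.span O (Set.range b) = B := by
  classical
  have hw : ∀ s : Finset (Fin n), ∃ w ∈ B, ∀ j ∈ s, w j ≠ 0 := by
    intro s
    induction s using Finset.induction_on with
    | empty => exact ⟨0, B.zero_mem, by simp⟩
    | insert a s _ ih =>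
      obtain ⟨w, hwB, hw⟩ := ih
      obtain ⟨v, hvB, hv⟩ := hproj a
      obtain ⟨c, hc⟩ := aux_c hinj w v
      refine ⟨w + c • v, B.add_mem hwB (B.smul_mem c hvB), fun j hj => hc j ?_⟩
      rcases Finset.mem_insert.1 hj with rfl | hj
      · exact Or.inl hv
      · exact Or.inr (hw j hj)
  obtain ⟨w, hwB, hw⟩ := hw Finset.univ
  obtain ⟨S, hS⟩ := hB
  choose c hc using fun u => aux_c hinj u w
  have hSB : ∀ s ∈ S, s ∈ B := fun s hs => hS ▸ Submodule.subset_span hs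
  let T : Finset (∀ j, E j) := insert w (S.image fun s => s + c s • w)
  have hT : ∀ t ∈ T, t ∈ B ∧ ∀ j, t j ≠ 0 := by
    intro t ht
    rcases Finset.mem_insert.1 ht with rfl | ht
    · exact ⟨hwB, fun j => hw j (Finset.mem_univ j)⟩
    · obtain ⟨s, hs, rfl⟩ := Finset.mem_image.1 ht
      exact ⟨B.add_mem (hSB s hs) (B.smul_mem _ hwB),
        fun j => hc s j (Or.inl (hw j (Finset.mem_univ j)))⟩
  have hr : Set.range (fun i => ((T.equivFin.symm i : T) : ∀ j, E j)) = (T : Set (∀ j, E j)) := by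
    ext t
    constructor
    · rintro ⟨i, rfl⟩
      exact (T.equivFin.symm i).2
    · intro ht
      exact ⟨T.equivFin ⟨t, ht⟩, by simp⟩
  refine ⟨T.card, fun i => (T.equivFin.symm i : T), fun i => (hT _ (T.equivFin.symm i).2).1,
    fun i => (hT _ (T.equivFin.symm i).2).2, ?_⟩
  rw [hr]
  apply le_antisymm
  · exact Submodule.span_le.2 fun t ht => (hT t ht).1
  · rw [← hS]
    refine Submodule.span_le.2 fun s hs => ?_
    have h1 : w ∈ Submodule.span O (T : Set (∀ j, E j)) :=
      Submodule.subset_span (Finset.mem_insert_self _ _)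
    have h2 : s + c s • w ∈ Submodule.span O (T : Set (∀ j, E j)) :=
      Submodule.subset_span (Finset.mem_insert_of_mem (Finset.mem_image_of_mem _ hs))
    have h3 := Submodule.sub_mem _ h2 (Submodule.smul_mem _ (c s) h1)
    rwa [add_sub_cancel_right] at h3
end

section
/- Let M' be an abelian group, M ⊆ M' a subgroup of finite index, and f : M' → M' an injective group homomorphism with f(M) ⊆ M. Then the quotient M'/f(M') is finite if and only if M/f(M) is finite, and in that case #(M'/f(M')) = #(M/f(M)). -/
/-- Let `M ⊆ M'` be a finite-index subgroup of an abelian group and `f : M' → M'` an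
injective homomorphism with `f(M) ⊆ M`.  Then `M'/f(M')` is finite iff `M/f(M)` is finite,
and their cardinalities agree. -/
theorem stmt_10 {M' : Type*} [AddCommGroup M'] (M : AddSubgroup M')
    (hM : Finite (M' ⧸ M)) (f : M' →+ M') (hf : Function.Injective f)
    (hfM : ∀ x ∈ M, f x ∈ M) :
    (Finite (M' ⧸ f.range) ↔ Finite (M ⧸ (M.map f).addSubgroupOf M)) ∧
      Nat.card (M' ⧸ f.range) = Nat.card (M ⧸ (M.map f).addSubgroupOf M) := by
  have hle : M.map f ≤ M := by
    rintro _ ⟨x, hx, rfl⟩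
    exact hfM x hx
  have hidx : M.index ≠ 0 := by
    have : Nat.card (M' ⧸ M) ≠ 0 := Nat.card_pos.ne'
    exact this
  have h1 : (M.map f).index = M.index * f.range.index :=
    AddSubgroup.index_map_of_injective M hf
  have h2 : (M.map f).relIndex M * M.index = (M.map f).index :=
    AddSubgroup.relIndex_mul_index hle
  have key : Nat.card (M' ⧸ f.range) = Nat.card (M ⧸ (M.map f).addSubgroupOf M) := by
    change f.range.index = (M.map f).relIndex M
    apply Nat.eq_of_mul_eq_mul_left (Nat.pos_of_ne_zero hidx)
    rw [← h1, ← h2, mul_comm]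
  refine ⟨⟨fun h => ?_, fun h => ?_⟩, key⟩
  · exact Nat.finite_of_card_ne_zero (key ▸ Nat.card_pos.ne')
  · exact Nat.finite_of_card_ne_zero (key.symm ▸ Nat.card_pos.ne')
end

section
/- Let k be a commutative ring, G a finite abelian group, and H, Γ ⊆ G subgroups; set Γ_H = Γ ∩ H. For any k[H]-module N there is an isomorphism of k[G/Γ]-modules (k[G] ⊗_{k[H]} N)^Γ ≅ k[G/Γ] ⊗_{k[H/Γ_H]} N^{Γ_H}, where the Γ-invariants of the induced module k[G] ⊗_{k[H]} N are taken for the G-action through left multiplication on k[G], N^{Γ_H} denotes the Γ_H-fixed points of N, and H/Γ_H is viewed as a subgroup of G/Γ. -/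
open scoped TensorProduct

/-- `k[G]` as an algebra over `k[H]` for a subgroup `H ≤ G`, via the inclusion `H → G`. -/
noncomputable instance monoidAlgebraSubgroupAlgebra
    {k : Type*} [CommRing k] {G : Type*} [CommGroup G] (H : Subgroup G) :
    Algebra (MonoidAlgebra k ↥H) (MonoidAlgebra k G) :=
  (MonoidAlgebra.mapDomainRingHom k H.subtype).toAlgebra

/-- `k[G/Γ]` as an algebra over `k[H/Γ_H]` (where `Γ_H = Γ ∩ H`), via the map of quotients
induced by the inclusion `H → G`. -/
noncomputable instance monoidAlgebraQuotAlgebra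
    {k : Type*} [CommRing k] {G : Type*} [CommGroup G] (H Γ : Subgroup G) :
    Algebra (MonoidAlgebra k (↥H ⧸ Γ.subgroupOf H)) (MonoidAlgebra k (G ⧸ Γ)) :=
  (MonoidAlgebra.mapDomainRingHom k
    (QuotientGroup.map (Γ.subgroupOf H) Γ H.subtype le_rfl)).toAlgebra

variable {k : Type*} [CommRing k] {G : Type*} [CommGroup G] (H Γ : Subgroup G)
variable (N : Type*) [AddCommGroup N] [Module (MonoidAlgebra k ↥H) N]

/-- The action of `g : G` on the induced module `k[G] ⊗_{k[H]} N`, by left multiplication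
on the first factor. -/
noncomputable def indAct (g : G) :
    (MonoidAlgebra k G ⊗[MonoidAlgebra k ↥H] N) →ₗ[MonoidAlgebra k ↥H]
      (MonoidAlgebra k G ⊗[MonoidAlgebra k ↥H] N) :=
  LinearMap.rTensor N
    (Algebra.lmul (MonoidAlgebra k ↥H) (MonoidAlgebra k G) (MonoidAlgebra.of k G g))

/-- The `Γ`-invariants of the induced module `k[G] ⊗_{k[H]} N`. -/
noncomputable def indInv :
    Submodule (MonoidAlgebra k ↥H) (MonoidAlgebra k G ⊗[MonoidAlgebra k ↥H] N) :=
  ⨅ γ : Γ, LinearMap.ker (indAct (k := k) H N (γ : G) - LinearMap.id)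

/-- The `Γ_H = Γ ∩ H`-invariants of `N`. -/
noncomputable def subInv : Submodule (MonoidAlgebra k ↥H) N :=
  ⨅ γ : (Γ.subgroupOf H), LinearMap.ker
    (LinearMap.lsmul (MonoidAlgebra k ↥H) N (MonoidAlgebra.of k ↥H (γ : ↥H)) - LinearMap.id)

section IndAux

open MonoidAlgebra

variable {R : Type*} [CommRing R] {K L : Type*} [CommGroup K] [CommGroup L]
  (φ : K →* L) (hφ : Function.Injective φ)
  [iA : Algebra (MonoidAlgebra R K) (MonoidAlgebra R L)]
  (hA : algebraMap (MonoidAlgebra R K) (MonoidAlgebra R L) = mapDomainRingHom R φ)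
  (M : Type*) [AddCommGroup M] [Module (MonoidAlgebra R K) M]

/-- restriction of functions from `L` to `K`, as a `R[K]`-linear map. -/
noncomputable def resAux : MonoidAlgebra R L →ₗ[MonoidAlgebra R K] MonoidAlgebra R K where
  toFun := comapDomain φ hφ
  map_add' := comapDomain_add _ _
  map_smul' := by
    intro r s
    simp only [RingHom.id_apply, Algebra.smul_def, hA, Algebra.algebraMap_self]
    induction r using MonoidAlgebra.induction_linear with
    | zero => simp
    | add a b ha hb => simp only [map_add, add_mul, comapDomain_add, ha, hb]
    | single a c =>
      induction s using MonoidAlgebra.induction_linear with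
      | zero => simp
      | add u v hu hv => simp only [mul_add, comapDomain_add, hu, hv]
      | single l d =>
        have h1 : mapDomainRingHom R φ (single a c) = single (φ a) c := mapDomain_single ..
        rw [h1, single_mul_single]
        by_cases hl : l ∈ Set.range φ
        · obtain ⟨b, rfl⟩ := hl
          rw [← map_mul, comapDomain_single_map, comapDomain_single_map, single_mul_single]
        · rw [comapDomain_single_of_not_mem_range hl, comapDomain_single_of_not_mem_range, mul_zero]
          rintro ⟨b, hb⟩
          exact hl ⟨a⁻¹ * b, by simp [hb]⟩

/-- left multiplication -/
noncomputable def actAux (g : L) :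
    (MonoidAlgebra R L ⊗[MonoidAlgebra R K] M) →ₗ[MonoidAlgebra R K]
      (MonoidAlgebra R L ⊗[MonoidAlgebra R K] M) :=
  LinearMap.rTensor M (Algebra.lmul (MonoidAlgebra R K) (MonoidAlgebra R L) (of R L g))

/-- evaluation at `x` -/
noncomputable def evAux (x : L) :
    (MonoidAlgebra R L ⊗[MonoidAlgebra R K] M) →ₗ[MonoidAlgebra R K] M :=
  (TensorProduct.lid (MonoidAlgebra R K) M).toLinearMap ∘ₗ
    (resAux φ hφ hA).rTensor M ∘ₗ actAux M x⁻¹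

lemma actAux_mul (g h : L) (t : MonoidAlgebra R L ⊗[MonoidAlgebra R K] M) :
    actAux M g (actAux M h t) = actAux M (g * h) t := by
  induction t using TensorProduct.induction_on with
  | zero => simp
  | add a b ha hb => simp only [map_add, ha, hb]
  | tmul s m => simp [actAux, single_mul_single, ← mul_assoc]

lemma evAux_act (x g : L) (t : MonoidAlgebra R L ⊗[MonoidAlgebra R K] M) :
    evAux φ hφ hA M x (actAux M g t) = evAux φ hφ hA M (g⁻¹ * x) t := by
  simp only [evAux, LinearMap.comp_apply, actAux_mul]
  congr 4
  simp [mul_comm]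

include hA in
lemma actAux_map (κ : K) (t : MonoidAlgebra R L ⊗[MonoidAlgebra R K] M) :
    actAux M (φ κ) t = of R K κ • t := by
  induction t using TensorProduct.induction_on with
  | zero => simp
  | add a b ha hb => simp only [map_add, smul_add, ha, hb]
  | tmul s m =>
    have h1 : mapDomainRingHom R φ (single κ 1) = single (φ κ) 1 := mapDomain_single ..
    simp [actAux, TensorProduct.smul_tmul', Algebra.smul_def, hA, h1]

lemma evAux_mul (x : L) (κ : K) (t : MonoidAlgebra R L ⊗[MonoidAlgebra R K] M) :
    evAux φ hφ hA M (x * φ κ) t = of R K κ⁻¹ • evAux φ hφ hA M x t := by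
  rw [← map_smul, ← actAux_map φ hA, evAux_act]
  congr 2
  simp [mul_comm]

lemma evAux_of_map (x : L) (κ : K) (m : M) :
    evAux φ hφ hA M x (of R L (x * φ κ) ⊗ₜ m) = of R K κ • m := by
  simp [evAux, actAux, single_mul_single, resAux, comapDomain_single_map]

lemma evAux_of_not (x l : L) (h : ∀ κ, l ≠ x * φ κ) (m : M) :
    evAux φ hφ hA M x (of R L l ⊗ₜ m) = 0 := by
  have : x⁻¹ * l ∉ Set.range φ := by
    rintro ⟨κ, hk⟩
    exact h κ (by simp [hk])
  simp [evAux, actAux, single_mul_single, resAux, comapDomain_single_of_not_mem_range this]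

/-- the inverse map -/
noncomputable def invAux [Fintype (L ⧸ φ.range)] :
    (L → M) →+ (MonoidAlgebra R L ⊗[MonoidAlgebra R K] M) where
  toFun f := ∑ q : L ⧸ φ.range, of R L q.out ⊗ₜ f q.out
  map_zero' := by simp
  map_add' f g := by simp [TensorProduct.tmul_add, Finset.sum_add_distrib]

omit iA in
lemma out_eq (l : L) : ∃ κ, l = (l : L ⧸ φ.range).out * φ κ := by
  obtain ⟨⟨_, κ, rfl⟩, h⟩ := QuotientGroup.mk_out_eq_mul φ.range l
  exact ⟨κ⁻¹, by simp [h]⟩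

include hA hφ in
lemma invAux_ev [Fintype (L ⧸ φ.range)] (t : MonoidAlgebra R L ⊗[MonoidAlgebra R K] M) :
    invAux (R := R) φ M (fun x => evAux φ hφ hA M x t) = t := by
  have hadd : ∀ a b : MonoidAlgebra R L ⊗[MonoidAlgebra R K] M,
      invAux (R := R) φ M (fun x => evAux φ hφ hA M x a) = a →
      invAux (R := R) φ M (fun x => evAux φ hφ hA M x b) = b →
      invAux (R := R) φ M (fun x => evAux φ hφ hA M x (a + b)) = a + b := by
    intro a b ha hb
    have : (fun x => evAux φ hφ hA M x (a + b)) =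
      (fun x => evAux φ hφ hA M x a) + (fun x => evAux φ hφ hA M x b) := by
      ext x; simp
    rw [this, map_add, ha, hb]
  have h0 : invAux (R := R) φ M (fun x => evAux φ hφ hA M x 0) = 0 := by
    have : (fun x => evAux φ hφ hA M x 0) = 0 := by ext x; simp
    rw [this, map_zero]
  induction t using TensorProduct.induction_on with
  | zero => exact h0
  | add a b ha hb => exact hadd a b ha hb
  | tmul s m =>
    induction s using MonoidAlgebra.induction_linear with
    | zero => rw [TensorProduct.zero_tmul]; exact h0
    | add a b ha hb => rw [TensorProduct.add_tmul]; exact hadd _ _ ha hb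
    | single l c =>
      have h1 : mapDomainRingHom R φ (single 1 c) = single (φ 1) c := mapDomain_single ..
      have : single l c = (single 1 c : MonoidAlgebra R K) • of R L l := by
        rw [Algebra.smul_def, hA, h1]
        simp [single_mul_single]
      rw [this, TensorProduct.smul_tmul]
      generalize (single 1 c : MonoidAlgebra R K) • m = m
      obtain ⟨κ, hκ⟩ := out_eq φ l
      simp only [invAux, AddMonoidHom.coe_mk, ZeroHom.coe_mk]
      rw [Finset.sum_eq_single (l : L ⧸ φ.range)]
      · set y := (l : L ⧸ φ.range).out with hy
        clear_value y
        subst hκ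
        rw [evAux_of_map, TensorProduct.tmul_smul,
          ← actAux_map φ hA]
        simp [actAux, single_mul_single, mul_comm]
      · intro q _ hq
        rw [evAux_of_not, TensorProduct.tmul_zero]
        rintro κ' rfl
        apply hq
        rw [QuotientGroup.mk_mul_of_mem _ (show φ κ' ∈ φ.range from ⟨κ', rfl⟩)]
        simp
      · simp

lemma ev_invAux [Fintype (L ⧸ φ.range)] (f : L → M)
    (hf : ∀ x κ, f (x * φ κ) = of R K κ⁻¹ • f x) (x : L) :
    evAux φ hφ hA M x (invAux (R := R) φ M f) = f x := by
  simp only [invAux, AddMonoidHom.coe_mk, ZeroHom.coe_mk, map_sum]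
  rw [Finset.sum_eq_single (x : L ⧸ φ.range)]
  · obtain ⟨κ, hκ⟩ := out_eq φ x
    have : (x : L ⧸ φ.range).out = x * φ κ⁻¹ := by
      rw [map_inv, eq_mul_inv_iff_mul_eq]; exact hκ.symm
    rw [this, evAux_of_map, hf, smul_smul, ← map_mul, inv_inv, inv_mul_cancel, map_one, one_smul]
  · intro q _ hq
    rw [evAux_of_not]
    intro κ' h
    apply hq
    rw [← QuotientGroup.out_eq' q, h, QuotientGroup.mk_mul_of_mem _ (show φ κ' ∈ φ.range from ⟨κ', rfl⟩)]
  · simp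

include hA hφ in
lemma ev_injective [Finite L] (t u : MonoidAlgebra R L ⊗[MonoidAlgebra R K] M)
    (h : ∀ x, evAux φ hφ hA M x t = evAux φ hφ hA M x u) : t = u := by
  have := Fintype.ofFinite (L ⧸ φ.range)
  rw [← invAux_ev φ hφ hA M t, ← invAux_ev φ hφ hA M u, funext h]

lemma ev_surjective [Finite L] (f : L → M)
    (hf : ∀ x κ, f (x * φ κ) = of R K κ⁻¹ • f x) :
    ∃ t, ∀ x, evAux φ hφ hA M x t = f x := by
  have := Fintype.ofFinite (L ⧸ φ.range)
  exact ⟨invAux (R := R) φ M f, ev_invAux φ hφ hA M f hf⟩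

end IndAux

lemma mem_indInv_iff (t : MonoidAlgebra k G ⊗[MonoidAlgebra k ↥H] N) :
    t ∈ indInv (k := k) H Γ N ↔ ∀ γ ∈ Γ, actAux N γ t = t := by
  simp [indInv, sub_eq_zero, indAct, actAux]

lemma mem_subInv_iff (n : N) :
    n ∈ subInv (k := k) H Γ N ↔ ∀ γ : H, (γ : G) ∈ Γ → MonoidAlgebra.of k ↥H γ • n = n := by
  simp [subInv, sub_eq_zero, Subgroup.mem_subgroupOf]

/-- Let `G` be finite abelian, `H, Γ ≤ G`, and `N` a `k[H]`-module.  Then there is an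
isomorphism of `k[G/Γ]`-modules `(k[G] ⊗_{k[H]} N)^Γ ≅ k[G/Γ] ⊗_{k[H/Γ_H]} N^{Γ_H}`,
where the canonical `k[H/Γ_H]`-module structure on `N^{Γ_H}` is characterized by the
hypotheses `hsmul` (group elements act through their classes) and `hscal` (compatibility
of scalars).  The isomorphism is an additive equivalence that is `k`-linear and
`G`-equivariant for the action of `G` on the left side and of `G/Γ` on the right side,
which expresses exactly `k[G/Γ]`-linearity. -/
theorem stmt_11 [Finite G]
    [instQ : Module (MonoidAlgebra k (↥H ⧸ Γ.subgroupOf H)) ↥(subInv (k := k) H Γ N)]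
    (hsmul : ∀ (h : ↥H) (x : ↥(subInv (k := k) H Γ N)),
      (↑(MonoidAlgebra.of k (↥H ⧸ Γ.subgroupOf H) ((h : ↥H ⧸ Γ.subgroupOf H)) • x) : N)
        = MonoidAlgebra.of k ↥H h • (x : N))
    (hscal : ∀ (c : k) (x : ↥(subInv (k := k) H Γ N)),
      (↑(algebraMap k (MonoidAlgebra k (↥H ⧸ Γ.subgroupOf H)) c • x) : N)
        = algebraMap k (MonoidAlgebra k ↥H) c • (x : N)) :
    ∃ e : ↥(indInv (k := k) H Γ N) ≃+
        (MonoidAlgebra k (G ⧸ Γ) ⊗[MonoidAlgebra k (↥H ⧸ Γ.subgroupOf H)] ↥(subInv (k := k) H Γ N)),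
      (∀ (c : k) (x : ↥(indInv (k := k) H Γ N)),
        e (algebraMap k (MonoidAlgebra k ↥H) c • x)
          = algebraMap k (MonoidAlgebra k (↥H ⧸ Γ.subgroupOf H)) c • e x) ∧
      (∀ (g : G) (x y : ↥(indInv (k := k) H Γ N)),
        indAct (k := k) H N g (x : MonoidAlgebra k G ⊗[MonoidAlgebra k ↥H] N)
            = (y : MonoidAlgebra k G ⊗[MonoidAlgebra k ↥H] N) →
        e y = LinearMap.rTensor ↥(subInv (k := k) H Γ N)
          (Algebra.lmul (MonoidAlgebra k (↥H ⧸ Γ.subgroupOf H)) (MonoidAlgebra k (G ⧸ Γ))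
            (MonoidAlgebra.of k (G ⧸ Γ) ((g : G ⧸ Γ)))) (e x)) := by
  have hφ : Function.Injective H.subtype := H.subtype_injective
  have hA : algebraMap (MonoidAlgebra k H) (MonoidAlgebra k G) =
    MonoidAlgebra.mapDomainRingHom k H.subtype := rfl
  let ψ := QuotientGroup.map (Γ.subgroupOf H) Γ H.subtype le_rfl
  have hψ : Function.Injective ψ := by
    rw [injective_iff_map_eq_one]
    intro a
    induction a using QuotientGroup.induction_on with
    | H z =>
      intro h
      have h2 : ((z : G) : G ⧸ Γ) = 1 := h
      rw [QuotientGroup.eq_one_iff] at h2 ⊢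
      exact h2
  have hB : algebraMap (MonoidAlgebra k (↥H ⧸ Γ.subgroupOf H)) (MonoidAlgebra k (G ⧸ Γ)) =
    MonoidAlgebra.mapDomainRingHom k ψ := rfl
  let T := evAux H.subtype hφ hA N
  let T' := evAux ψ hψ hB (subInv (k := k) H Γ N)
  have ex1 : ∀ t : indInv (k := k) H Γ N, ∃ u, ∀ x : G, (T' (x : G ⧸ Γ) u : N) = T x t := by
    intro t
    have ht := (mem_indInv_iff H Γ N _).1 t.2
    have inv : ∀ x : G, ∀ γ ∈ Γ, T (x * γ) t = T x t := by
      intro x γ hγ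
      conv_rhs => rw [← ht γ⁻¹ (Γ.inv_mem hγ)]
      simp only [T]
      rw [evAux_act]
      simp [mul_comm]
    have memb : ∀ x : G, T x t ∈ subInv (k := k) H Γ N := by
      intro x
      rw [mem_subInv_iff]
      intro γ hγ
      have h1 := evAux_mul H.subtype hφ hA N x γ⁻¹ t
      rw [inv_inv] at h1
      exact h1.symm.trans (inv _ _ (Γ.inv_mem hγ))
    let F : G ⧸ Γ → subInv (k := k) H Γ N := fun q => ⟨T q.out t, memb _⟩
    have hF : ∀ x : G, F x = ⟨T x t, memb x⟩ := by
      intro x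
      obtain ⟨γ, h⟩ := QuotientGroup.mk_out_eq_mul Γ x
      apply Subtype.ext
      simp only [F, h]
      exact inv x γ γ.2
    obtain ⟨u, hu⟩ := ev_surjective ψ hψ hB (subInv (k := k) H Γ N) F (by
      intro x κ
      induction x using QuotientGroup.induction_on with
      | H x =>
      induction κ using QuotientGroup.induction_on with
      | H h =>
      have h1 : (x : G ⧸ Γ) * ψ (h : ↥H ⧸ Γ.subgroupOf H) = ((x * (h : G) : G) : G ⧸ Γ) := rfl
      apply Subtype.ext
      rw [h1, hF, hF, ← QuotientGroup.mk_inv, hsmul]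
      exact evAux_mul H.subtype hφ hA N x h t)
    exact ⟨u, fun x => by simp only [T']; rw [hu, hF]⟩
  have ex2 : ∀ u, ∃ t : indInv (k := k) H Γ N, ∀ x : G, (T' (x : G ⧸ Γ) u : N) = T x t := by
    intro u
    obtain ⟨t, ht⟩ := ev_surjective H.subtype hφ hA N (fun x : G => (T' (x : G ⧸ Γ) u : N)) (by
      intro x h
      have h1 : ((x * H.subtype h : G) : G ⧸ Γ) = (x : G ⧸ Γ) * ψ (h : ↥H ⧸ Γ.subgroupOf H) := rfl
      simp only [T']
      rw [h1, evAux_mul, ← QuotientGroup.mk_inv, hsmul])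
    refine ⟨⟨t, ?_⟩, fun x => (ht x).symm⟩
    rw [mem_indInv_iff]
    intro γ hγ
    apply ev_injective H.subtype hφ hA N
    intro x
    rw [evAux_act, ht, ht, mul_comm, QuotientGroup.mk_mul_of_mem _ (Γ.inv_mem hγ)]
  have un1 : ∀ (t : indInv (k := k) H Γ N) u v, (∀ x : G, (T' (x : G ⧸ Γ) u : N) = T x t) →
      (∀ x : G, (T' (x : G ⧸ Γ) v : N) = T x t) → u = v := by
    intro t u v hu hv
    apply ev_injective ψ hψ hB
    intro x
    induction x using QuotientGroup.induction_on with
    | H x => exact Subtype.ext ((hu x).trans (hv x).symm)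
  have un2 : ∀ (s t : indInv (k := k) H Γ N) u, (∀ x : G, (T' (x : G ⧸ Γ) u : N) = T x s) →
      (∀ x : G, (T' (x : G ⧸ Γ) u : N) = T x t) → s = t := by
    intro s t u hu hv
    apply Subtype.ext
    apply ev_injective H.subtype hφ hA
    intro x
    exact (hu x).symm.trans (hv x)
  choose a ha using ex1
  choose b hb using ex2
  refine ⟨{ toFun := a, invFun := b, left_inv := fun t => un2 _ _ _ (hb (a t)) (ha t),
            right_inv := fun u => un1 _ _ _ (ha (b u)) (hb u), map_add' := fun s t => ?_ }, ?_, ?_⟩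
  · apply un1 _ _ _ (ha (s + t))
    intro x
    rw [map_add, Submodule.coe_add, Submodule.coe_add, map_add, ha, ha]
  · intro c t
    apply un1 _ _ _ (ha _)
    intro x
    rw [map_smul, hscal, Submodule.coe_smul, map_smul]
    exact congrArg _ (ha t x)
  · intro g s t h
    apply un1 _ _ _ (ha _)
    intro x
    rw [← h]
    refine (congrArg _ (evAux_act ψ hψ hB _ (x : G ⧸ Γ) (g : G ⧸ Γ) (a s))).trans ?_
    refine Eq.trans ?_ (evAux_act H.subtype hφ hA N x g s).symm
    exact ha s (g⁻¹ * x)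
end

section
/- Let G be a finite abelian group and I ⊆ G a subgroup. Let π : ℤ[G] → ℤ[G/I] be the natural projection of group rings and let ν : ℤ[G/I] → ℤ[G] be the additive map sending the class of g ∈ G to (∑_{σ ∈ I} σ)·g (this is well-defined). Fix an element y ∈ ℤ[G/I]. If a₁, a₂ ∈ ℤ[G] and β₁, β₂ ∈ ℤ[G/I] satisfy π(a_i) = y·β_i for i = 1, 2, then a₁·ν(β₂) = a₂·ν(β₁) in ℤ[G]; equivalently, the determinant of the 2×2 matrix with rows (a₁, ν(β₁)) and (a₂, ν(β₂)) vanishes in ℤ[G]. -/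
/-- Let `G` be finite abelian, `I ⊆ G` a subgroup, `π : ℤ[G] → ℤ[G/I]` the natural
projection and `ν : ℤ[G/I] → ℤ[G]` the additive map sending the class of `g` to
`(∑_{σ ∈ I} σ) · g`.  If `π aᵢ = y · βᵢ` for `i = 1, 2`, then `a₁ · ν β₂ = a₂ · ν β₁`,
i.e. the determinant of the matrix with rows `(a₁, ν β₁)`, `(a₂, ν β₂)` vanishes. -/
theorem stmt_12 {G : Type*} [CommGroup G] [Fintype G] (I : Subgroup G) [Fintype I]
    (ν : MonoidAlgebra ℤ (G ⧸ I) →+ MonoidAlgebra ℤ G)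
    (hν : ∀ g : G, ν (MonoidAlgebra.of ℤ (G ⧸ I) (g : G ⧸ I)) =
      (∑ σ : I, MonoidAlgebra.of ℤ G (σ : G)) * MonoidAlgebra.of ℤ G g)
    (y : MonoidAlgebra ℤ (G ⧸ I)) (a₁ a₂ : MonoidAlgebra ℤ G)
    (β₁ β₂ : MonoidAlgebra ℤ (G ⧸ I))
    (h₁ : MonoidAlgebra.mapDomainRingHom ℤ (QuotientGroup.mk' I) a₁ = y * β₁)
    (h₂ : MonoidAlgebra.mapDomainRingHom ℤ (QuotientGroup.mk' I) a₂ = y * β₂) :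
    a₁ * ν β₂ = a₂ * ν β₁ := by
  have key : ∀ (a : MonoidAlgebra ℤ G) (β : MonoidAlgebra ℤ (G ⧸ I)),
      a * ν β = ν (MonoidAlgebra.mapDomainRingHom ℤ (QuotientGroup.mk' I) a * β) := by
    intro a β
    induction a using MonoidAlgebra.induction_on with
    | of g =>
      induction β using MonoidAlgebra.induction_on with
      | of q =>
        obtain ⟨h, rfl⟩ := QuotientGroup.mk_surjective q
        have e : MonoidAlgebra.mapDomainRingHom ℤ (QuotientGroup.mk' I)
            (MonoidAlgebra.of ℤ G g) = MonoidAlgebra.of ℤ (G ⧸ I) (g : G ⧸ I) := by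
          simp
        rw [e, ← map_mul, ← QuotientGroup.mk_mul, hν, hν, map_mul]
        ring
      | add x y hx hy => rw [map_add, mul_add, hx, hy, mul_add, map_add]
      | smul r x hx => rw [map_zsmul, mul_smul_comm, hx, mul_smul_comm, map_zsmul]
    | add x y hx hy => rw [map_add, add_mul, hx, hy, add_mul, map_add]
    | smul r x hx => rw [map_zsmul, smul_mul_assoc, hx, smul_mul_assoc, map_zsmul]
  rw [key, key, h₁, h₂]
  congr 1
  ring
end

section
/- Let Γ be a group and Δ ⊴ Γ a normal subgroup with abelian quotient G = Γ/Δ. Let M be a finite abelian group of odd order equipped with a G-action, let c ∈ Γ be an element whose image c̄ ∈ G acts on M as multiplication by −1, and let φ : Δ → M be a group homomorphism satisfying φ(γ δ γ⁻¹) = γ̄ · φ(δ) for all γ ∈ Γ and δ ∈ Δ, where γ̄ is the image of γ in G. For γ ∈ Γ, the commutator γ c γ⁻¹ c⁻¹ lies in Δ, and one defines λ(γ) to be the unique element m ∈ M with 2m = φ(γ c γ⁻¹ c⁻¹). Then λ : Γ → M is a 1-cocycle, i.e. λ(γγ') = λ(γ) + γ̄ · λ(γ') for all γ, γ' ∈ Γ,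 and its restriction to Δ equals φ. -/
/-- Let `Δ ⊴ Γ` with abelian quotient `G = Γ/Δ`, `M` a finite abelian group of odd order
with a `G`-action, `c ∈ Γ` whose image acts as `-1` on `M`, and `φ : Δ → M` an equivariant
homomorphism.  Let `lam : Γ → M` satisfy `2 · lam γ = φ(γcγ⁻¹c⁻¹)` (the unique half).
Then each commutator `γcγ⁻¹c⁻¹` lies in `Δ`, `lam` is a 1-cocycle, and `lam` restricts to
`φ` on `Δ`. -/
theorem stmt_14 {Γ : Type*} [Group Γ] (Δ : Subgroup Γ) [hΔ : Δ.Normal]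
    (hab : ∀ a b : Γ ⧸ Δ, a * b = b * a)
    {M : Type*} [AddCommGroup M] [Finite M] (hodd : Odd (Nat.card M))
    [DistribMulAction (Γ ⧸ Δ) M]
    (c : Γ) (hc : ∀ m : M, (c : Γ ⧸ Δ) • m = -m)
    (φ : Δ → M) (hφ : ∀ δ δ' : Δ, φ (δ * δ') = φ δ + φ δ')
    (hequiv : ∀ (γ : Γ) (δ : Δ),
      φ ⟨γ * (δ : Γ) * γ⁻¹, hΔ.conj_mem (δ : Γ) δ.2 γ⟩ = (γ : Γ ⧸ Δ) • φ δ)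
    (lam : Γ → M)
    (hlam : ∀ (γ : Γ) (h : γ * c * γ⁻¹ * c⁻¹ ∈ Δ),
      lam γ + lam γ = φ ⟨γ * c * γ⁻¹ * c⁻¹, h⟩) :
    (∀ γ : Γ, γ * c * γ⁻¹ * c⁻¹ ∈ Δ) ∧
    (∀ γ γ' : Γ, lam (γ * γ') = lam γ + (γ : Γ ⧸ Δ) • lam γ') ∧
    (∀ δ : Δ, lam (δ : Γ) = φ δ) := by
  have hmem : ∀ γ : Γ, γ * c * γ⁻¹ * c⁻¹ ∈ Δ := by
    intro γ
    rw [← QuotientGroup.eq_one_iff]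
    have h := hab (γ : Γ ⧸ Δ) (c : Γ ⧸ Δ)
    simp only [QuotientGroup.mk_mul, QuotientGroup.mk_inv]
    rw [h]
    group
  have half : ∀ m n : M, m + m = n + n → m = n := by
    intro m n h
    obtain ⟨k, hk⟩ := hodd
    have h2 : (2 : ℕ) • (m - n) = 0 := by
      rw [two_nsmul, sub_add_sub_comm, h, sub_self]
    have h1 : Nat.card M • (m - n) = 0 := card_nsmul_eq_zero'
    rw [hk, add_nsmul, mul_comm, mul_nsmul', h2, nsmul_zero, zero_add, one_nsmul] at h1
    exact sub_eq_zero.mp h1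
  refine ⟨hmem, ?_, ?_⟩
  · intro γ γ'
    apply half
    have e : (⟨γ * γ' * c * (γ * γ')⁻¹ * c⁻¹, hmem (γ * γ')⟩ : Δ)
        = ⟨γ * (γ' * c * γ'⁻¹ * c⁻¹) * γ⁻¹, hΔ.conj_mem _ (hmem γ') γ⟩
          * ⟨γ * c * γ⁻¹ * c⁻¹, hmem γ⟩ := by
      apply Subtype.ext
      simp only [Subgroup.coe_mul]
      group
    have h3 := hequiv γ ⟨γ' * c * γ'⁻¹ * c⁻¹, hmem γ'⟩
    rw [hlam _ (hmem _), e, hφ, h3, ← hlam, ← hlam, smul_add]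
    abel
  · intro δ
    apply half
    have e : (⟨(δ : Γ) * c * (δ : Γ)⁻¹ * c⁻¹, hmem δ⟩ : Δ)
        = δ * ⟨c * ((δ⁻¹ : Δ) : Γ) * c⁻¹, hΔ.conj_mem _ (δ⁻¹).2 c⟩ := by
      apply Subtype.ext
      simp only [Subgroup.coe_mul, Subgroup.coe_inv]
      group
    have h1 : φ 1 = 0 := by
      have := hφ 1 1
      rw [mul_one] at this
      exact left_eq_add.mp this
    have h2 : φ δ⁻¹ = - φ δ := by
      have := hφ δ⁻¹ δ
      rw [inv_mul_cancel, h1] at this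
      exact eq_neg_of_add_eq_zero_left this.symm
    rw [hlam _ (hmem _), e, hφ, hequiv c δ⁻¹, hc, h2, neg_neg]
end
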